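/- Let (N, D, θ) be a sandpile model in dimension d with complete neighborhood N, set r = max{|v|_∞ : v ∈ N}, and let c be a configuration lying within the elementary hypercube of side n with c(x) < 2θ for every cell x. Then no cell topples more than 8·d·θ·r·n^d · Σ_{z∈ℤ^d} c(z) times during the parallel evolution: for every t ≥ 0 and every x ∈ ℤ^d, #{s < t : F^s(c)(x) ≥ θ} ≤ 8dθrn^d · Σ_{z∈ℤ^d} c(z). -/

import Mathlib

/-- A sandpile model in dimension `d`: a finite nonempty neighborhood
`N ⊆ ℤ^d \ {0}` and a distribution `D` with `D v ≥ 1` for `v ∈ N`. -/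
structure Sandpile (d : ℕ) where
  N : Finset (Fin d → ℤ)
  D : (Fin d → ℤ) → ℕ
  N_nonempty : N.Nonempty
  zero_not_mem : (0 : Fin d → ℤ) ∉ N
  D_pos : ∀ v ∈ N, 1 ≤ D v

/-- The stability threshold `θ = Σ_{v ∈ N} D(v)`. -/
def Sandpile.θ {d : ℕ} (M : Sandpile d) : ℕ := ∑ v ∈ M.N, M.D v

/-- The Heaviside function: `H n = 1` if `n ≥ 0`, else `0`. -/
def Heaviside (n : ℤ) : ℕ := if 0 ≤ n then 1 else 0

/-- The parallel global rule `F`. -/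
def Sandpile.F {d : ℕ} (M : Sandpile d) (c : (Fin d → ℤ) → ℕ) : (Fin d → ℤ) → ℕ :=
  fun x => c x - M.θ * Heaviside ((c x : ℤ) - (M.θ : ℤ))
    + ∑ y ∈ M.N, M.D y * Heaviside ((c (x + y) : ℤ) - (M.θ : ℤ))

/-- A configuration is stable when every cell holds fewer than `θ` grains. -/
def Sandpile.Stable {d : ℕ} (M : Sandpile d) (c : (Fin d → ℤ) → ℕ) : Prop :=
  ∀ x, c x < M.θ

/-- A configuration is finite when its total number of grains is finite,
equivalently its support is finite. -/
def FiniteConfig {d : ℕ} (c : (Fin d → ℤ) → ℕ) : Prop :=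
  (Function.support c).Finite

/-- Sequential toppling at an unstable cell `x`: remove `θ` grains from `x`
and add `D(y−x)` grains to each `y ∈ x + N`, other cells unchanged. -/
def Sandpile.SeqStepAt {d : ℕ} (M : Sandpile d) (x : Fin d → ℤ)
    (c c' : (Fin d → ℤ) → ℕ) : Prop :=
  M.θ ≤ c x ∧
    ∀ y, c' y = (if y = x then c y - M.θ else c y)
      + (if y - x ∈ M.N then M.D (y - x) else 0)

/-- `c ⇀ c'`: a sequential toppling at some unstable cell. -/
def Sandpile.SeqStep {d : ℕ} (M : Sandpile d)
    (c c' : (Fin d → ℤ) → ℕ) : Prop :=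
  ∃ x, M.SeqStepAt x c c'

/-- `c ⇀* c'`: reflexive–transitive closure of `⇀`. -/
def Sandpile.SeqReach {d : ℕ} (M : Sandpile d)
    (c c' : (Fin d → ℤ) → ℕ) : Prop :=
  Relation.ReflTransGen M.SeqStep c c'

/-- The neighborhood is complete: every element of `ℤ^d` is a nonnegative
integer combination of elements of `N`. -/
def Sandpile.Complete {d : ℕ} (M : Sandpile d) : Prop :=
  ∀ z : Fin d → ℤ, ∃ a : (Fin d → ℤ) → ℕ, z = ∑ v ∈ M.N, (a v : ℤ) • v

/-- The configuration lies within the elementary hypercube of side `n`: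
`c x = 0` for all `x ∉ {0,…,n−1}^d`. -/
def InCube {d : ℕ} (n : ℕ) (c : (Fin d → ℤ) → ℕ) : Prop :=
  ∀ x : Fin d → ℤ, (¬ ∀ i, 0 ≤ x i ∧ x i < (n : ℤ)) → c x = 0

/-- Add one grain at cell `y` (i.e. `c + 1_y`). -/
def addGrain {d : ℕ} (c : (Fin d → ℤ) → ℕ) (y : Fin d → ℤ) : (Fin d → ℤ) → ℕ :=
  fun x => if x = y then c x + 1 else c x

/-- `r` is the maximal sup-norm of a neighborhood vector:
`r = max{|v|_∞ : v ∈ N}`. -/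
def Sandpile.IsRadius {d : ℕ} (M : Sandpile d) (r : ℕ) : Prop :=
  (∀ v ∈ M.N, ∀ i, (v i).natAbs ≤ r) ∧ (∃ v ∈ M.N, ∃ i, (v i).natAbs = r)

namespace Sandpile

variable {d : ℕ}

/-- The number of topplings at `x` during the first `t` parallel steps from `c`. -/
def topplings (M : Sandpile d) (c : (Fin d → ℤ) → ℕ) (t : ℕ) (x : Fin d → ℤ) : ℕ :=
  ((Finset.range t).filter (fun s => M.θ ≤ M.F^[s] c x)).card

theorem heaviside_sub (a b : ℕ) : Heaviside ((a : ℤ) - b) = if b ≤ a then 1 else 0 := by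
  simp [Heaviside]

theorem topplings_succ (M : Sandpile d) (c : (Fin d → ℤ) → ℕ) (t : ℕ) (x : Fin d → ℤ) :
    M.topplings c (t + 1) x =
      M.topplings c t x + Heaviside ((M.F^[t] c x : ℤ) - (M.θ : ℤ)) := by
  rw [heaviside_sub, topplings, topplings, Finset.range_add_one, Finset.filter_insert]
  split_ifs <;> simp

theorem F_add (M : Sandpile d) (c : (Fin d → ℤ) → ℕ) (x : Fin d → ℤ) :
    M.F c x + M.θ * Heaviside ((c x : ℤ) - (M.θ : ℤ)) =
      c x + ∑ y ∈ M.N, M.D y * Heaviside ((c (x + y) : ℤ) - (M.θ : ℤ)) := by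
  have h : M.θ * Heaviside ((c x : ℤ) - (M.θ : ℤ)) ≤ c x := by
    rw [heaviside_sub]
    split_ifs <;> simp [*]
  unfold F
  omega

/-- The balance of grains at `x` after `t` parallel steps. -/
theorem iterate_F_add (M : Sandpile d) (c : (Fin d → ℤ) → ℕ) (t : ℕ) (x : Fin d → ℤ) :
    M.F^[t] c x + M.θ * M.topplings c t x =
      c x + ∑ y ∈ M.N, M.D y * M.topplings c t (x + y) := by
  induction t with
  | zero => simp [topplings]
  | succ t ih =>
    have h := M.F_add (M.F^[t] c) x
    simp only [Function.iterate_succ_apply', topplings_succ, mul_add, Finset.sum_add_distrib]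
    omega

theorem θ_pos (M : Sandpile d) : 0 < M.θ :=
  Finset.sum_pos (fun v hv => M.D_pos v hv) M.N_nonempty

theorem finiteConfig_F (M : Sandpile d) {c : (Fin d → ℤ) → ℕ} (hc : FiniteConfig c) :
    FiniteConfig (M.F c) := by
  refine (hc.union (M.N.finite_toSet.biUnion fun v _ =>
    hc.preimage (add_left_injective v).injOn)).subset fun x hx => ?_
  by_contra hn
  simp only [Set.mem_union, Set.mem_iUnion, Set.mem_preimage, Function.mem_support, not_or,
    not_exists, not_not, Finset.mem_coe] at hn hx
  have h := M.F_add c x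
  rw [hn.1, Finset.sum_eq_zero] at h
  · omega
  · intro y hy
    rw [hn.2 y hy, heaviside_sub, if_neg (by have := M.θ_pos; omega), mul_zero]

theorem finiteConfig_iterate_F (M : Sandpile d) {c : (Fin d → ℤ) → ℕ} (hc : FiniteConfig c)
    (t : ℕ) : FiniteConfig (M.F^[t] c) := by
  induction t with
  | zero => exact hc
  | succ t ih =>
    rw [Function.iterate_succ_apply']
    exact M.finiteConfig_F ih

theorem finiteConfig_topplings (M : Sandpile d) {c : (Fin d → ℤ) → ℕ} (hc : FiniteConfig c)
    (t : ℕ) : FiniteConfig (M.topplings c t) := by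
  refine ((Finset.range t).finite_toSet.biUnion fun s _ =>
    M.finiteConfig_iterate_F hc s).subset fun x hx => ?_
  obtain ⟨s, hs⟩ := Finset.card_pos.1 (Nat.pos_of_ne_zero hx)
  rw [Finset.mem_filter] at hs
  simp only [Set.mem_iUnion]
  exact ⟨s, hs.1, (M.θ_pos.trans_le hs.2).ne'⟩

/-- The parallel evolution preserves the total number of grains. -/
theorem finsum_iterate_F (M : Sandpile d) {c : (Fin d → ℤ) → ℕ} (hc : FiniteConfig c) (t : ℕ) :
    ∑ᶠ z, M.F^[t] c z = ∑ᶠ z, c z := by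
  have hu := M.finiteConfig_topplings hc t
  have hs : ∀ v, (Function.support fun z => M.topplings c t (z + v)).Finite := fun v =>
    hu.preimage (add_left_injective v).injOn
  have hmul : ∀ (k : ℕ) (g : (Fin d → ℤ) → ℕ), g.support.Finite →
      (Function.support fun z => k * g z).Finite := fun k g hg =>
    hg.subset (Function.support_mul_subset_right _ _)
  have key := finsum_congr (M.iterate_F_add c t)
  have hsum : (Function.support fun z => ∑ y ∈ M.N, M.D y * M.topplings c t (z + y)).Finite := by
    refine (M.N.finite_toSet.biUnion fun v _ => hmul (M.D v) _ (hs v)).subset ?_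
    intro z hz
    obtain ⟨v, hv, hne⟩ := Finset.exists_ne_zero_of_sum_ne_zero hz
    exact Set.mem_biUnion (Finset.mem_coe.2 hv) hne
  rw [finsum_add_distrib (M.finiteConfig_iterate_F hc t) (hmul _ _ hu),
    finsum_add_distrib hc hsum,
    finsum_sum_comm _ _ fun v _ => hmul _ _ (hs v), ← mul_finsum] at key
  have h : ∀ v ∈ M.N, ∑ᶠ z, M.D v * M.topplings c t (z + v) =
      M.D v * ∑ᶠ z, M.topplings c t z := fun v _ => by
    rw [← mul_finsum]
    congr 1
    exact finsum_comp_equiv (Equiv.addRight v)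
  rw [Finset.sum_congr rfl h, ← Finset.sum_mul] at key
  exact Nat.add_right_cancel key

theorem sum_le_finsum {c : (Fin d → ℤ) → ℕ} (hc : FiniteConfig c) (A : Finset (Fin d → ℤ)) :
    ∑ z ∈ A, c z ≤ ∑ᶠ z, c z := by
  classical
  rw [finsum_eq_sum_of_support_subset (s := A ∪ hc.toFinset) c fun z hz => by
    simp [show z ∈ hc.toFinset from hc.mem_toFinset.2 hz]]
  exact Finset.sum_le_sum_of_subset Finset.subset_union_left

/-- The toppling counts of a cell and of a cell feeding it differ by at most the total number
of grains: the grains entering a superlevel set are compared with those leaving it. -/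
theorem topplings_le_add (M : Sandpile d) {c : (Fin d → ℤ) → ℕ} (hc : FiniteConfig c) (t : ℕ)
    {w : Fin d → ℤ} (hw : w ∈ M.N) (b : Fin d → ℤ) :
    M.topplings c t b ≤ M.topplings c t (b + w) + ∑ᶠ z, c z := by
  classical
  set u := M.topplings c t with hu
  by_contra! hlt
  have hk : 0 < u b := by omega
  have hfin : {z | u b ≤ u z}.Finite :=
    (M.finiteConfig_topplings hc t).subset fun z (hz : u b ≤ u z) => (hk.trans_le hz).ne'
  set A := hfin.toFinset with hA
  have hmem : ∀ z, z ∈ A ↔ u b ≤ u z := fun z => by simp [hA]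
  have hbA : b ∈ A := (hmem b).2 le_rfl
  set g : (Fin d → ℤ) → ℤ := fun z => max ((u z : ℤ) - u b) 0 with hg
  have hshift : ∀ v, ∑ z ∈ A, g (z + v) ≤ ∑ z ∈ A, ((u z : ℤ) - u b) := fun v => by
    calc ∑ z ∈ A, g (z + v) = ∑ z ∈ A.map (addRightEmbedding v), g z := by simp
      _ ≤ ∑ z ∈ A ∪ A.map (addRightEmbedding v), g z :=
        Finset.sum_le_sum_of_subset_of_nonneg Finset.subset_union_right
          fun _ _ _ => le_max_right _ _
      _ = ∑ z ∈ A, g z := by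
        refine (Finset.sum_subset Finset.subset_union_left fun z _ hz => ?_).symm
        rw [hmem] at hz
        exact max_eq_right (by omega)
      _ = ∑ z ∈ A, ((u z : ℤ) - u b) := by
        refine Finset.sum_congr rfl fun z hz => ?_
        rw [hmem] at hz
        exact max_eq_left (by omega)
  have hloss : ∀ v, 0 ≤ ∑ z ∈ A, ((u z : ℤ) - u (z + v)) := fun v => by
    have h1 : ∑ z ∈ A, ((u (z + v) : ℤ) - u b) ≤ ∑ z ∈ A, g (z + v) :=
      Finset.sum_le_sum fun z _ => le_max_left _ _
    have h2 := hshift v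
    simp only [Finset.sum_sub_distrib] at h1 h2 ⊢
    omega
  have hlossw : (u b : ℤ) - u (b + w) ≤ ∑ z ∈ A, ((u z : ℤ) - u (z + w)) := by
    have h1 : ((u b : ℤ) - u (b + w)) ≤ ∑ z ∈ A, (g (z + w) - ((u (z + w) : ℤ) - u b)) := by
      refine le_trans ?_ (Finset.single_le_sum
        (f := fun z => g (z + w) - ((u (z + w) : ℤ) - u b)) (fun z _ => ?_) hbA)
      · have := le_max_right ((u (b + w) : ℤ) - u b) 0
        simp only [hg]
        omega
      · exact sub_nonneg.2 (le_max_left _ _)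
    have h2 := hshift w
    simp only [Finset.sum_sub_distrib] at h1 h2 ⊢
    omega
  have hbal : ∑ v ∈ M.N, (M.D v : ℤ) * ∑ z ∈ A, ((u z : ℤ) - u (z + v)) ≤ ∑ z ∈ A, (c z : ℤ) := by
    simp only [Finset.mul_sum]
    rw [Finset.sum_comm]
    refine Finset.sum_le_sum fun z _ => ?_
    have h := M.iterate_F_add c t z
    rw [← hu] at h
    have hθ : (M.θ : ℤ) * u z = ∑ v ∈ M.N, (M.D v : ℤ) * u z := by
      rw [← Finset.sum_mul, θ]
      push_cast
      rfl
    zify at h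
    simp only [mul_sub, Finset.sum_sub_distrib]
    rw [← hθ]
    have := Int.natCast_nonneg (M.F^[t] c z)
    linarith
  have hsingle := Finset.single_le_sum
    (f := fun v => (M.D v : ℤ) * ∑ z ∈ A, ((u z : ℤ) - u (z + v)))
    (fun v _ => mul_nonneg (Int.natCast_nonneg _) (hloss v)) hw
  have hD : (1 : ℤ) ≤ M.D w := by exact_mod_cast M.D_pos w hw
  have hS : (∑ z ∈ A, (c z : ℤ)) ≤ ((∑ᶠ z, c z : ℕ) : ℤ) := by
    exact_mod_cast sum_le_finsum hc A
  have := le_mul_of_one_le_left (hloss w) hD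
  omega

/-- If every cell of `W` feeds some cell of `W`, then `W` holds a grain as soon as one of its
cells has toppled. -/
theorem exists_pos_of_topplings_pos (M : Sandpile d) (c : (Fin d → ℤ) → ℕ)
    {W : Set (Fin d → ℤ)} (hW : ∀ a ∈ W, ∃ v ∈ M.N, a - v ∈ W) (t : ℕ)
    (h : ∃ a ∈ W, 0 < M.topplings c t a) : ∃ b ∈ W, 0 < M.F^[t] c b := by
  induction t with
  | zero => simp [topplings] at h
  | succ t ih =>
    simp only [Function.iterate_succ_apply']
    by_cases hex : ∃ a ∈ W, M.θ ≤ M.F^[t] c a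
    · obtain ⟨a, ha, hta⟩ := hex
      obtain ⟨v, hv, hav⟩ := hW a ha
      refine ⟨a - v, hav, ?_⟩
      have hsingle := Finset.single_le_sum
        (f := fun y => M.D y * Heaviside ((M.F^[t] c (a - v + y) : ℤ) - (M.θ : ℤ)))
        (fun _ _ => Nat.zero_le _) hv
      simp only [sub_add_cancel, heaviside_sub, if_pos hta, mul_one] at hsingle
      have := M.D_pos v hv
      simp only [F, heaviside_sub]
      omega
    · push Not at hex
      obtain ⟨a, ha, hta⟩ := h
      rw [topplings_succ, heaviside_sub, if_neg (hex a ha).not_ge, add_zero] at hta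
      obtain ⟨b, hb, hpos⟩ := ih ⟨a, ha, hta⟩
      refine ⟨b, hb, ?_⟩
      have hF := M.F_add (M.F^[t] c) b
      rw [heaviside_sub, if_neg (hex b hb).not_ge] at hF
      omega

theorem Complete.exists_pos {M : Sandpile d} (hM : M.Complete) (i : Fin d) :
    ∃ v ∈ M.N, 0 < v i := by
  by_contra! h
  obtain ⟨a, ha⟩ := hM (Pi.single i 1)
  have hi := congrFun ha i
  simp only [Pi.single_eq_same, Finset.sum_apply, Pi.smul_apply, smul_eq_mul] at hi
  have := Finset.sum_nonpos fun v hv =>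
    mul_nonpos_of_nonneg_of_nonpos (Int.natCast_nonneg (a v)) (h v hv)
  omega

theorem Complete.exists_neg {M : Sandpile d} (hM : M.Complete) (i : Fin d) :
    ∃ v ∈ M.N, v i < 0 := by
  by_contra! h
  obtain ⟨a, ha⟩ := hM (-Pi.single i 1)
  have hi := congrFun ha i
  simp only [Pi.neg_apply, Pi.single_eq_same, Finset.sum_apply, Pi.smul_apply, smul_eq_mul] at hi
  have := Finset.sum_nonneg fun v hv => mul_nonneg (Int.natCast_nonneg (a v)) (h v hv)
  omega

/-- Walking from `x` in a direction `w ∈ N` meets a cell that never toppled within a number of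
steps linear in the number of grains: each slab of width `2r` that is met holds a grain. -/
theorem exists_topplings_eq_zero {M : Sandpile d} (hM : M.Complete) {r : ℕ}
    (hr : ∀ v ∈ M.N, ∀ i, (v i).natAbs ≤ r) {c : (Fin d → ℤ) → ℕ} (hc : FiniteConfig c)
    (t : ℕ) (x : Fin d → ℤ) {w : Fin d → ℤ} (hw : w ∈ M.N) {i : Fin d} (hwi : 0 < w i) :
    ∃ k ≤ 2 * r * ∑ᶠ z, c z, M.topplings c t (x + k • w) = 0 := by
  set S := ∑ᶠ z, c z with hS
  by_contra! hne
  have hwr := hr w hw i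
  have hr0 : (0 : ℤ) < 2 * r := by omega
  have hgrain : ∀ j : ℕ, j ≤ S → ∃ b : Fin d → ℤ,
      (b i - x i) / (2 * r) = j ∧ 0 < M.F^[t] c b := by
    intro j hj
    refine M.exists_pos_of_topplings_pos c (W := {b | (b i - x i) / (2 * r) = j}) ?_ t ?_
    · intro a ha
      obtain ⟨p, hp, hpi⟩ := hM.exists_pos i
      obtain ⟨q, hq, hqi⟩ := hM.exists_neg i
      have hpr := hr p hp i
      have hqr := hr q hq i
      simp only [Set.mem_ofPred_eq, Int.ediv_eq_iff_of_pos hr0, Pi.sub_apply] at ha ⊢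
      by_cases hlow : a i - x i < j * (2 * r) + r
      · exact ⟨q, hq, by constructor <;> linarith [ha.1, ha.2, show -q i ≤ r by omega]⟩
      · exact ⟨p, hp, by constructor <;> linarith [ha.1, ha.2, show p i ≤ r by omega]⟩
    · have hm : (0 : ℤ) ≤ 2 * r * j := by positivity
      -- the first step at which the walk enters the slab
      set q := -(-(2 * r * j : ℤ) / w i) with hq
      have hdiv := Int.ediv_mul_le (-(2 * r * j : ℤ)) hwi.ne'
      have hlt := Int.lt_ediv_add_one_mul_self (-(2 * r * j : ℤ)) hwi
      have h1 : 2 * r * j ≤ q * w i := by rw [hq]; linarith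
      have h2 : q * w i < 2 * r * j + w i := by rw [hq]; linarith
      have hq0 : 0 ≤ q := by
        by_contra! hneg
        nlinarith
      have hqle : q ≤ 2 * r * j := by
        by_contra! hgt
        nlinarith
      lift q to ℕ using hq0 with k
      have hk : k ≤ 2 * r * j := by exact_mod_cast hqle
      refine ⟨x + k • w, ?_, Nat.pos_of_ne_zero (hne k (hk.trans (Nat.mul_le_mul_left _ hj)))⟩
      simp only [Set.mem_ofPred_eq, Int.ediv_eq_iff_of_pos hr0, Pi.add_apply, Pi.smul_apply,
        nsmul_eq_mul (α := ℤ)]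
      constructor <;> linarith [show w i ≤ r by omega]
  choose! b hb hpos using hgrain
  have hinj : Set.InjOn b (Finset.range (S + 1)) := by
    intro j hj k hk hjk
    simp only [Finset.coe_range, Set.mem_Iio] at hj hk
    have h1 := hb j (by omega)
    have h2 := hb k (by omega)
    rw [hjk, h2] at h1
    exact_mod_cast h1.symm
  have hle := sum_le_finsum (M.finiteConfig_iterate_F hc t) ((Finset.range (S + 1)).image b)
  rw [M.finsum_iterate_F hc t, ← hS, Finset.sum_image hinj] at hle
  have hcard := Finset.card_nsmul_le_sum (Finset.range (S + 1)) (fun j => M.F^[t] c (b j)) 1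
    fun j hj => hpos j (by simpa [Nat.lt_succ_iff] using hj)
  simp only [Finset.card_range, smul_eq_mul, mul_one] at hcard
  omega

theorem topplings_le_nsmul_add (M : Sandpile d) {c : (Fin d → ℤ) → ℕ} (hc : FiniteConfig c)
    (t : ℕ) {w : Fin d → ℤ} (hw : w ∈ M.N) (x : Fin d → ℤ) (k : ℕ) :
    M.topplings c t x ≤ M.topplings c t (x + k • w) + k * ∑ᶠ z, c z := by
  induction k with
  | zero => simp
  | succ k ih =>
    have h := M.topplings_le_add hc t hw (x + k • w)
    rw [add_assoc, ← succ_nsmul] at h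
    rw [add_mul, one_mul]
    omega

end Sandpile

theorem InCube.support_subset {d n : ℕ} {c : (Fin d → ℤ) → ℕ} (hc : InCube n c) :
    Function.support c ⊆ (Fintype.piFinset fun _ : Fin d => Finset.Ico (0 : ℤ) n) := by
  intro z hz
  by_contra h
  exact hz (hc z (by simpa using h))

theorem InCube.finiteConfig {d n : ℕ} {c : (Fin d → ℤ) → ℕ} (hc : InCube n c) :
    FiniteConfig c :=
  (Finset.finite_toSet _).subset hc.support_subset

theorem InCube.finsum_le {d n : ℕ} {c : (Fin d → ℤ) → ℕ} (hc : InCube n c) {m : ℕ}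
    (hm : ∀ x, c x ≤ m) : ∑ᶠ z, c z ≤ n ^ d * m := by
  rw [finsum_eq_sum_of_support_subset _ hc.support_subset]
  refine (Finset.sum_le_card_nsmul _ _ m fun z _ => hm z).trans ?_
  simp [Fintype.card_piFinset]

/-- for a complete neighborhood of radius `r` and a
configuration `c` within the elementary hypercube of side `n` with all cells
below `2θ`, no cell topples more than `8·d·θ·r·n^d · Σ_z c(z)` times during
the parallel evolution. -/
theorem sandpile_toppling_count_bound {d : ℕ} (hd : 1 ≤ d) (M : Sandpile d)
    (hcomp : M.Complete) (r : ℕ) (hr : M.IsRadius r) (n : ℕ)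
    (c : (Fin d → ℤ) → ℕ) (hcube : InCube n c) (hbound : ∀ x, c x < 2 * M.θ)
    (t : ℕ) (x : Fin d → ℤ) :
    ((Finset.range t).filter (fun s => M.θ ≤ M.F^[s] c x)).card
      ≤ 8 * d * M.θ * r * n ^ d * ∑ᶠ z, c z := by
  have hc := hcube.finiteConfig
  let i : Fin d := ⟨0, hd⟩
  obtain ⟨w, hw, hwi⟩ := hcomp.exists_pos i
  obtain ⟨k, hk, hzero⟩ := Sandpile.exists_topplings_eq_zero hcomp hr.1 hc t x hw hwi
  have hle := M.topplings_le_nsmul_add hc t hw x k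
  rw [hzero, zero_add] at hle
  have hS := hcube.finsum_le fun z => (hbound z).le
  refine hle.trans (Nat.mul_le_mul_right _ (hk.trans ?_))
  calc 2 * r * ∑ᶠ z, c z ≤ 2 * r * (n ^ d * (2 * M.θ)) := Nat.mul_le_mul_left _ hS
    _ = 4 * (M.θ * r * n ^ d) := by ring
    _ ≤ (8 * d) * (M.θ * r * n ^ d) := Nat.mul_le_mul_right _ (by omega)
    _ = 8 * d * M.θ * r * n ^ d := by ring
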